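/- arXiv:0711.2758 — 2 statements merged into one kernel-verified Lean document; each statement's English description precedes it below -/
import Mathlib

section
/- Let k be a field and let I ⊆ k[x₀,x₁] be a strongly stable monomial ideal with dim_k k[x₀,x₁]/I = 11 that contains no monomial of degree 1 and is generated by its monomials of degree at most 6. For each i ≥ 0 set λ_i = min{ j : x₀^i x₁^j ∈ I }. If λ_{i+1} ≥ λ_i − 2 for every i ≥ 0 (the Gruson–Peskine condition for general hyperplane sections of reduced irreducible curves), then I equals one of exactly two ideals: (x₁⁵, x₀x₁³, x₀²x₁², x₀³x₁, x₀⁴) or (x₁⁵, x₀x₁⁴, x₀²x₁², x₀³). -/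
open MvPolynomial

/-- The total degree of an exponent vector. -/
def expDeg2 (d : Fin 2 →₀ ℕ) : ℕ := d.sum fun _ e => e

/-- `I ⊆ k[x₀,x₁]` is a monomial ideal: it is generated by (some set of) monomials. -/
def IsMonomialIdeal2 (k : Type*) [Field k] (I : Ideal (MvPolynomial (Fin 2) k)) : Prop :=
  ∃ S : Set (Fin 2 →₀ ℕ), I = Ideal.span ((fun d => monomial d (1 : k)) '' S)

/-- `I` is strongly stable (Borel-fixed): for every monomial `m ∈ I` divisible by `x₁`,
the monomial `x₀ · m / x₁` also lies in `I`. -/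
def IsStronglyStable2 (k : Type*) [Field k] (I : Ideal (MvPolynomial (Fin 2) k)) : Prop :=
  ∀ d : Fin 2 →₀ ℕ, monomial d (1 : k) ∈ I →
    ∀ i j : Fin 2, i < j → d j ≠ 0 →
      monomial (d - Finsupp.single j 1 + Finsupp.single i 1) (1 : k) ∈ I

/-- `lam k I i = min { j : x₀^i x₁^j ∈ I }`. -/
noncomputable def lam (k : Type*) [Field k] (I : Ideal (MvPolynomial (Fin 2) k)) (i : ℕ) : ℕ :=
  sInf {j : ℕ | monomial (Finsupp.single (0 : Fin 2) i + Finsupp.single (1 : Fin 2) j) (1 : k) ∈ I}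


/-- Exponent vector of `x₀^i x₁^j`. -/
noncomputable abbrev ev (i j : ℕ) : Fin 2 →₀ ℕ :=
  Finsupp.single (0 : Fin 2) i + Finsupp.single (1 : Fin 2) j

lemma ev_eta (d : Fin 2 →₀ ℕ) : ev (d 0) (d 1) = d := by
  ext i; fin_cases i <;> simp [ev]

lemma mono_ev (k : Type*) [Field k] (i j : ℕ) :
    monomial (ev i j) (1 : k) = X 0 ^ i * X 1 ^ j := by
  rw [X_pow_eq_monomial, X_pow_eq_monomial, monomial_mul, one_mul]

lemma mono_up {k : Type*} [Field k] (I : Ideal (MvPolynomial (Fin 2) k)) {a b i j : ℕ}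
    (h : (X 0 ^ a * X 1 ^ b : MvPolynomial (Fin 2) k) ∈ I) (ha : a ≤ i) (hb : b ≤ j) :
    (X 0 ^ i * X 1 ^ j : MvPolynomial (Fin 2) k) ∈ I := by
  obtain ⟨a', rfl⟩ := Nat.exists_eq_add_of_le ha
  obtain ⟨b', rfl⟩ := Nat.exists_eq_add_of_le hb
  have := I.mul_mem_left (X 0 ^ a' * X 1 ^ b') h
  convert this using 1
  ring

lemma card_compl {k : Type*} [Field k] (I : Ideal (MvPolynomial (Fin 2) k))
    (hmon : IsMonomialIdeal2 k I) :
    Module.finrank k (MvPolynomial (Fin 2) k ⧸ I) =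
      Nat.card {d : Fin 2 →₀ ℕ | monomial d (1 : k) ∉ I} := by
  obtain ⟨S, hS⟩ := hmon
  have hmem : ∀ f : MvPolynomial (Fin 2) k, f ∈ I ↔ ∀ d ∈ f.support, monomial d (1 : k) ∈ I := by
    intro f
    rw [hS, mem_ideal_span_monomial_image]
    refine forall₂_congr fun d _ => ?_
    rw [mem_ideal_span_monomial_image]
    classical
    simp [support_monomial]
  set A : Set (Fin 2 →₀ ℕ) := {d | monomial d (1 : k) ∉ I} with hA
  let φ : MvPolynomial (Fin 2) k →ₗ[k] (A →₀ k) :=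
    (Finsupp.lcomapDomain (fun x : A => (x : Fin 2 →₀ ℕ)) Subtype.val_injective).comp
      (AddMonoidAlgebra.coeffLinearEquiv k).toLinearMap
  have hφ : ∀ f a, φ f a = coeff (a : Fin 2 →₀ ℕ) f := fun f a => rfl
  have hsurj : Function.Surjective φ := by
    intro g
    refine ⟨g.sum fun a c => monomial (a : Fin 2 →₀ ℕ) c, ?_⟩
    ext a
    classical
    rw [hφ, Finsupp.sum, coeff_sum]
    simp only [coeff_monomial]
    simp [Subtype.val_inj]
    exact fun h => h.symm
  have hker : LinearMap.ker φ = I.restrictScalars k := by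
    ext f
    rw [LinearMap.mem_ker, Submodule.restrictScalars_mem, hmem]
    constructor
    · intro h d hd
      by_contra hc
      have := DFunLike.congr_fun h ⟨d, hc⟩
      rw [hφ] at this
      exact (mem_support_iff.1 hd) this
    · intro h
      ext a
      rw [hφ]
      by_contra hc
      exact a.2 (h _ (mem_support_iff.2 hc))
  have e1 := (LinearMap.quotKerEquivOfSurjective φ hsurj).finrank_eq
  rw [hker] at e1
  rw [← Module.finrank_eq_nat_card_basis (Finsupp.basisSingleOne (R := k) (ι := A)), ← e1]
  rfl

lemma comb (l : ℕ → ℕ) (h1 : ∀ i, l (i + 1) ≤ l i - 1) (h2 : ∀ i, l i ≤ l (i + 1) + 2)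
    (hs : ∑ i ∈ Finset.range (l 0), l i = 11) :
    (l 0 = 5 ∧ l 1 = 3 ∧ l 2 = 2 ∧ l 3 = 1 ∧ l 4 = 0) ∨
    (l 0 = 5 ∧ l 1 = 4 ∧ l 2 = 2 ∧ l 3 = 0) := by
  have hpos : 0 < l 0 := by
    rcases Nat.eq_zero_or_pos (l 0) with h | h
    · simp [h] at hs
    · exact h
  have hle : l 0 ≤ 11 := by
    rw [← hs]
    exact Finset.single_le_sum (f := l) (fun _ _ => Nat.zero_le _) (Finset.mem_range.2 hpos)
  have a0 := h1 0
  have a1 := h1 1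
  have a2 := h1 2
  have a3 := h1 3
  have b0 := h2 0
  have b1 := h2 1
  have b2 := h2 2
  have b3 := h2 3
  have b4 := h2 4
  have a4 := h1 4
  norm_num at a0 a1 a2 a3 b0 b1 b2 b3 a4 b4
  generalize hn : l 0 = n at *
  interval_cases n <;> simp only [Finset.sum_range_succ, Finset.sum_range_zero, hn] at hs <;> omega

lemma main_lam (k : Type*) [Field k] (I : Ideal (MvPolynomial (Fin 2) k))
    (hmon : IsMonomialIdeal2 k I) (hss : IsStronglyStable2 k I)
    (hcolen : Module.finrank k (MvPolynomial (Fin 2) k ⧸ I) = 11) :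
    (∀ i j, (X 0 ^ i * X 1 ^ j : MvPolynomial (Fin 2) k) ∈ I ↔ lam k I i ≤ j) ∧
    (∀ i, lam k I (i + 1) ≤ lam k I i - 1) ∧
    ∑ i ∈ Finset.range (lam k I 0), lam k I i = 11 := by
  rw [card_compl I hmon] at hcolen
  have hfin : {d : Fin 2 →₀ ℕ | monomial d (1 : k) ∉ I}.Finite := by
    apply Set.finite_coe_iff.1
    apply Nat.finite_of_card_ne_zero
    omega
  have hne : ∀ i, ∃ j, (X 0 ^ i * X 1 ^ j : MvPolynomial (Fin 2) k) ∈ I := by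
    intro i
    by_contra! hc
    refine Set.infinite_of_injective_forall_mem (f := fun j => ev i j) ?_ ?_ hfin
    · intro a b hab
      have := DFunLike.congr_fun hab 1
      simpa [ev] using this
    · intro j
      simp only [Set.mem_ofPred_eq, mono_ev]
      exact hc j
  have hlam : ∀ i, lam k I i =
      sInf {j : ℕ | (X 0 ^ i * X 1 ^ j : MvPolynomial (Fin 2) k) ∈ I} := by
    intro i
    simp only [← mono_ev]
    rfl
  have hP : ∀ i j, (X 0 ^ i * X 1 ^ j : MvPolynomial (Fin 2) k) ∈ I ↔ lam k I i ≤ j := by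
    intro i j
    constructor
    · intro h
      rw [hlam]
      exact Nat.sInf_le h
    · intro h
      have h0 : (X 0 ^ i * X 1 ^ (lam k I i) : MvPolynomial (Fin 2) k) ∈ I := by
        rw [hlam]
        exact Nat.sInf_mem (s := {j : ℕ | (X 0 ^ i * X 1 ^ j : MvPolynomial (Fin 2) k) ∈ I}) (hne i)
      exact mono_up I h0 le_rfl h
  have hstep : ∀ i, lam k I (i + 1) ≤ lam k I i - 1 := by
    intro i
    rcases Nat.eq_zero_or_pos (lam k I i) with h | h
    · rw [h, ← hP]
      exact mono_up I ((hP i 0).2 h.le) (Nat.le_succ i) le_rfl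
    · rw [← hP]
      have h0 := (hP i (lam k I i)).2 le_rfl
      rw [← mono_ev] at h0
      have h3 := hss _ h0 0 1 (by decide) (by simp [ev]; omega)
      rw [← ev_eta (ev i (lam k I i) - _ + _), mono_ev] at h3
      simpa [ev] using h3
  refine ⟨hP, hstep, ?_⟩
  have hdec : ∀ i, lam k I i ≤ lam k I 0 - i := by
    intro i
    induction i with
    | zero => simp
    | succ n ih => have := hstep n; omega
  rw [← hcolen]
  have : {d : Fin 2 →₀ ℕ | monomial d (1 : k) ∉ I} =
      (fun p : (_ : ℕ) × ℕ => ev p.1 p.2) ''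
        ((Finset.range (lam k I 0)).sigma fun i => Finset.range (lam k I i) :
          Finset ((_ : ℕ) × ℕ)) := by
    ext d
    simp only [Set.mem_ofPred_eq, Set.mem_image, Finset.mem_coe, Finset.mem_sigma, Finset.mem_range]
    constructor
    · intro h
      rw [← ev_eta d, mono_ev, hP] at h
      have := hdec (d 0)
      exact ⟨⟨d 0, d 1⟩, ⟨by dsimp only; omega, by dsimp only; omega⟩, ev_eta d⟩
    · rintro ⟨⟨i, j⟩, ⟨_, h⟩, rfl⟩
      rw [mono_ev, hP]
      dsimp only at h ⊢
      omega
  rw [this, Nat.card_image_of_injective]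
  · rw [Nat.card_coe_set_eq, Set.ncard_coe_finset, Finset.card_sigma]
    simp
  · rintro ⟨a, b⟩ ⟨c, d⟩ h
    have e0 := DFunLike.congr_fun h 0
    have e1 := DFunLike.congr_fun h 1
    simp [ev] at e0 e1
    subst e0 e1
    rfl

lemma le_of_gens {k : Type*} [Field k] (I J : Ideal (MvPolynomial (Fin 2) k))
    (hmon : IsMonomialIdeal2 k I)
    (h : ∀ i j, (X 0 ^ i * X 1 ^ j : MvPolynomial (Fin 2) k) ∈ I →
      (X 0 ^ i * X 1 ^ j : MvPolynomial (Fin 2) k) ∈ J) : I ≤ J := by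
  obtain ⟨S, hS⟩ := hmon
  rw [hS, Ideal.span_le]
  rintro _ ⟨d, hd, rfl⟩
  have hd' : monomial d (1 : k) ∈ I := hS ▸ Ideal.subset_span ⟨d, hd, rfl⟩
  rw [← ev_eta d, mono_ev] at hd'
  have := h _ _ hd'
  rw [← mono_ev, ev_eta] at this
  exact this

/-- A strongly stable monomial ideal in `k[x₀,x₁]` of colength 11, with no monomial of
degree 1, generated by its monomials of degree at most 6, and satisfying the
Gruson–Peskine condition `λ_{i+1} ≥ λ_i − 2`, equals
`(x₁⁵, x₀x₁³, x₀²x₁², x₀³x₁, x₀⁴)` or `(x₁⁵, x₀x₁⁴, x₀²x₁², x₀³)`. -/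
theorem planar_hyperplane_gins_degree_eleven
    (k : Type*) [Field k] (I : Ideal (MvPolynomial (Fin 2) k))
    (hmon : IsMonomialIdeal2 k I) (hss : IsStronglyStable2 k I)
    (hcolen : Module.finrank k (MvPolynomial (Fin 2) k ⧸ I) = 11)
    (hdeg1 : ∀ d : Fin 2 →₀ ℕ, expDeg2 d = 1 → monomial d (1 : k) ∉ I)
    (hgen : I = Ideal.span ((fun d => monomial d (1 : k)) ''
      {d : Fin 2 →₀ ℕ | expDeg2 d ≤ 6 ∧ monomial d (1 : k) ∈ I}))
    (hGP : ∀ i : ℕ, lam k I i ≤ lam k I (i + 1) + 2) :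
    I = Ideal.span {X 1 ^ 5, X 0 * X 1 ^ 3, X 0 ^ 2 * X 1 ^ 2, X 0 ^ 3 * X 1,
        (X 0 : MvPolynomial (Fin 2) k) ^ 4} ∨
    I = Ideal.span {X 1 ^ 5, X 0 * X 1 ^ 4, X 0 ^ 2 * X 1 ^ 2,
        (X 0 : MvPolynomial (Fin 2) k) ^ 3} := by
  obtain ⟨hP, hstep, hsum⟩ := main_lam k I hmon hss hcolen
  rcases comb (lam k I) hstep hGP hsum with ⟨h0, h1, h2, h3, h4⟩ | ⟨h0, h1, h2, h3⟩
  · left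
    apply le_antisymm
    · apply le_of_gens _ _ hmon
      intro i j hij
      rw [hP] at hij
      rcases (by omega : i = 0 ∨ i = 1 ∨ i = 2 ∨ i = 3 ∨ 4 ≤ i) with rfl | rfl | rfl | rfl | hi
      · exact mono_up _ (a := 0) (b := 5) (Ideal.subset_span (by simp)) le_rfl (by omega)
      · exact mono_up _ (a := 1) (b := 3) (Ideal.subset_span (by simp)) le_rfl (by omega)
      · exact mono_up _ (a := 2) (b := 2) (Ideal.subset_span (by simp)) le_rfl (by omega)
      · exact mono_up _ (a := 3) (b := 1) (Ideal.subset_span (by simp)) le_rfl (by omega)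
      · exact mono_up _ (a := 4) (b := 0) (Ideal.subset_span (by simp)) hi (by omega)
    · rw [Ideal.span_le]
      rintro x (rfl | rfl | rfl | rfl | rfl)
      · simpa using (hP 0 5).2 h0.le
      · simpa using (hP 1 3).2 h1.le
      · simpa using (hP 2 2).2 h2.le
      · simpa using (hP 3 1).2 h3.le
      · simpa using (hP 4 0).2 h4.le
  · right
    apply le_antisymm
    · apply le_of_gens _ _ hmon
      intro i j hij
      rw [hP] at hij
      rcases (by omega : i = 0 ∨ i = 1 ∨ i = 2 ∨ 3 ≤ i) with rfl | rfl | rfl | hi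
      · exact mono_up _ (a := 0) (b := 5) (Ideal.subset_span (by simp)) le_rfl (by omega)
      · exact mono_up _ (a := 1) (b := 4) (Ideal.subset_span (by simp)) le_rfl (by omega)
      · exact mono_up _ (a := 2) (b := 2) (Ideal.subset_span (by simp)) le_rfl (by omega)
      · exact mono_up _ (a := 3) (b := 0) (Ideal.subset_span (by simp)) hi (by omega)
    · rw [Ideal.span_le]
      rintro x (rfl | rfl | rfl | rfl)
      · simpa using (hP 0 5).2 h0.le
      · simpa using (hP 1 4).2 h1.le
      · simpa using (hP 2 2).2 h2.le
      · simpa using (hP 3 0).2 h3.le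
end

section
/- Let F = 𝔽₃₂₀₀₃ = ℤ/32003ℤ (32003 is prime), and let φ : F[x₀,x₁,x₂,x₃,x₄] → F[t,u] be the F-algebra homomorphism determined by x₀ ↦ t¹⁰ + t⁹u + tu⁹ + u¹⁰, x₁ ↦ 7t¹⁰ + 101t⁸u² + 355t⁵u⁵ + 999u¹⁰, x₂ ↦ 29t¹⁰ + 99t³u⁷ + 67t²u⁸ + 83u¹⁰, x₃ ↦ 61t¹⁰ + 79t⁵u⁵ + t³u⁷ + 901tu⁹ + 53u¹⁰, x₄ ↦ 741t¹⁰ + t⁸u² + t⁷u³ + t⁶u⁴ + t⁴u⁶ + t²u⁸ + 9001u¹⁰. Let I = ker φ. Then the initial ideal of I with respect to the graded reverse-lexicographic monomial order with x₀ > x₁ > x₂ > x₃ > x₄ is generated by its monomials of total degree at most 4; that is, in(I) equals the ideal generated by the leading monomials of the nonzero elements of I of total degree at most 4. (This witnesses that a generic rational curve of degree 10 in ℙ⁴ is 4-regular.) -/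
open MvPolynomial

noncomputable section

/-- The field `𝔽₃₂₀₀₃`. -/
abbrev F32003 := ZMod 32003

/-- The total degree of an exponent vector in five variables. -/
def expDeg5 (d : Fin 5 →₀ ℕ) : ℕ := d.sum fun _ e => e

/-- The strict graded reverse-lexicographic order (degrevlex) on exponent vectors,
with `x₀ > x₁ > x₂ > x₃ > x₄`: `a` is smaller than `b` if `a` has smaller total degree,
or they have equal total degree and at the *last* index where `a` and `b` differ, the
entry of `a` is larger. -/
def DegRevLexLT (a b : Fin 5 →₀ ℕ) : Prop :=
  expDeg5 a < expDeg5 b ∨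
    (expDeg5 a = expDeg5 b ∧ ∃ i : Fin 5, b i < a i ∧ ∀ j : Fin 5, i < j → a j = b j)

/-- `d` is the exponent of the leading monomial of `f` with respect to degrevlex:
`d` occurs in `f`, and every other exponent occurring in `f` is degrevlex-smaller. -/
def IsLeadExponent (f : MvPolynomial (Fin 5) F32003) (d : Fin 5 →₀ ℕ) : Prop :=
  d ∈ f.support ∧ ∀ e ∈ f.support, e ≠ d → DegRevLexLT e d

/-- The initial ideal of `I` with respect to degrevlex: the ideal generated by the leading
monomials of all nonzero elements of `I`. -/
def initialIdeal (I : Ideal (MvPolynomial (Fin 5) F32003)) :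
    Ideal (MvPolynomial (Fin 5) F32003) :=
  Ideal.span {m | ∃ f ∈ I, f ≠ 0 ∧ ∃ d : Fin 5 →₀ ℕ,
    IsLeadExponent f d ∧ m = monomial d (1 : F32003)}

/-- The parameterization of a generic degree-10 rational curve in `ℙ⁴` over `𝔽₃₂₀₀₃`,
with `t = X 0`, `u = X 1`. -/
def curveMap : MvPolynomial (Fin 5) F32003 →ₐ[F32003] MvPolynomial (Fin 2) F32003 :=
  aeval fun i : Fin 5 =>
    match i with
    | 0 => X 0 ^ 10 + X 0 ^ 9 * X 1 + X 0 * X 1 ^ 9 + X 1 ^ 10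
    | 1 => 7 * X 0 ^ 10 + 101 * X 0 ^ 8 * X 1 ^ 2 + 355 * X 0 ^ 5 * X 1 ^ 5 + 999 * X 1 ^ 10
    | 2 => 29 * X 0 ^ 10 + 99 * X 0 ^ 3 * X 1 ^ 7 + 67 * X 0 ^ 2 * X 1 ^ 8 + 83 * X 1 ^ 10
    | 3 => 61 * X 0 ^ 10 + 79 * X 0 ^ 5 * X 1 ^ 5 + X 0 ^ 3 * X 1 ^ 7 + 901 * X 0 * X 1 ^ 9
        + 53 * X 1 ^ 10
    | 4 => 741 * X 0 ^ 10 + X 0 ^ 8 * X 1 ^ 2 + X 0 ^ 7 * X 1 ^ 3 + X 0 ^ 6 * X 1 ^ 4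
        + X 0 ^ 4 * X 1 ^ 6 + X 0 ^ 2 * X 1 ^ 8 + 9001 * X 1 ^ 10


def bezA : List ℕ := [7574, 4657, 20521, 5394, 16111, 2257, 18740, 11047, 17318, 29966]

def bezB : List ℕ := [16748, 29877, 13946, 61, 21192, 31976, 21529, 16869, 14036, 11440]

/-- Coefficients expressing `t^j` (`j < 10`) through ten quadrics and eleven multiples of `g₄`. -/
def quadCert : List (List ℕ) :=
  [[14658, 20973, 30838, 5965, 21432, 14487, 12140, 26771, 17043, 30096, 7463, 2419, 4536, 28985,
    16963, 11780, 3355, 14214, 4502, 16722, 5619],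
   [6787, 15642, 29238, 9765, 16255, 16835, 28682, 6600, 12852, 819, 14602, 29027, 5108, 29043,
    30917, 15069, 29754, 19643, 30437, 25138, 1072],
   [17648, 29760, 29921, 19967, 15545, 13662, 20731, 6335, 25191, 4734, 18933, 7490, 3823, 29583,
    31944, 10620, 14812, 4529, 26812, 22338, 16513],
   [25860, 18730, 19037, 25024, 15356, 28973, 2743, 23272, 1503, 10669, 15977, 30509, 23910,
    14252, 20024, 22174, 4924, 20845, 36, 7184, 567],
   [7151, 24735, 17439, 11886, 21796, 16863, 16233, 25208, 21583, 6561, 26574, 22849, 19851, 5913,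
    12354, 560, 25088, 13713, 5763, 18644, 26979],
   [29839, 16768, 26391, 11644, 6796, 10674, 21542, 9587, 7637, 25558, 2383, 27500, 9870, 11330,
    22584, 8051, 20272, 29430, 23356, 19105, 1902],
   [4907, 26832, 8429, 1163, 29068, 22941, 11549, 27219, 14011, 27497, 18540, 25641, 11227, 23623,
    381, 13391, 3568, 12843, 31040, 24530, 5924],
   [31247, 31742, 29877, 24583, 687, 2686, 16772, 19538, 31719, 15826, 26648, 22592, 25545, 14584,
    1202, 4322, 6367, 9033, 29535, 22293, 31245],
   [16164, 25287, 18139, 22246, 9685, 6283, 6742, 3974, 1962, 4583, 18421, 7605, 3335, 1430,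
    31820, 23787, 25447, 23830, 8240, 13113, 766],
   [15199, 18898, 17891, 14321, 15574, 30200, 7425, 23712, 3139, 20676, 23047, 26539, 8403, 18838,
    31537, 29577, 30947, 7512, 25333, 19539, 26076]]

/-- Coefficients expressing `t^j` (`j < 31`) through the cubic products of the `gᵢ`. -/
def cubCert : List (List ℕ) :=
  [[23837, 14551, 23126, 10649, 8725, 21122, 12237, 19749, 22772, 15439, 28617, 24565, 13395,
    8226, 29343, 16265, 2456, 9342, 16608, 6330, 12924, 31572, 14929, 15115, 6250, 22704, 13842,
    11851, 3733, 23241, 21625],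
   [27828, 11597, 26780, 30835, 6625, 13232, 18267, 22950, 19590, 15367, 24961, 2787, 9022, 24396,
    26011, 12137, 14082, 15442, 31181, 31902, 19177, 9843, 16937, 11175, 12239, 28269, 6843, 6690,
    8178, 8261, 4350],
   [13560, 19872, 21926, 16380, 8722, 30734, 10162, 17022, 23371, 23433, 213, 1454, 17447, 14406,
    7507, 7379, 10838, 12950, 31105, 21603, 12967, 20389, 10031, 29140, 3904, 20805, 17712, 13634,
    19440, 19969, 29122],
   [17067, 8054, 1028, 25159, 29848, 15307, 29925, 576, 4345, 17628, 20704, 26576, 31615, 23197,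
    29305, 30343, 1194, 5990, 27921, 16054, 27250, 16600, 1088, 24250, 20331, 3936, 20640, 690,
    19880, 3518, 24604],
   [3225, 547, 20671, 30095, 28460, 3922, 21643, 2019, 6053, 12873, 780, 10539, 20885, 6166,
    24984, 14880, 2234, 21113, 17452, 15860, 28318, 2826, 24667, 12686, 13100, 759, 27949, 5803,
    5926, 21231, 23515],
   [28341, 2556, 7234, 8264, 25138, 24803, 24743, 24199, 23352, 18927, 30291, 17227, 14442, 19059,
    17263, 1688, 10245, 15562, 20707, 31041, 14492, 3866, 12595, 4886, 9579, 26734, 8959, 31699,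
    15820, 24419, 1143],
   [17064, 8241, 7856, 7285, 9957, 9512, 27752, 27342, 24680, 12803, 27556, 21932, 25214, 13623,
    11342, 27987, 3225, 23592, 19225, 27860, 9243, 19033, 272, 20280, 17037, 22906, 4146, 24207,
    1365, 7079, 24940],
   [22470, 12632, 19146, 1426, 25049, 15170, 29336, 2535, 19654, 12761, 3840, 4382, 28193, 9668,
    15045, 6889, 16841, 1364, 24210, 2216, 4966, 30631, 14703, 20173, 25130, 5190, 14807, 11951,
    17095, 30043, 18981],
   [16258, 26096, 31390, 3479, 11183, 25530, 30830, 31284, 984, 8869, 8233, 11452, 29930, 29995,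
    29680, 23044, 15813, 7181, 12629, 10862, 2650, 14635, 24231, 4755, 5954, 16184, 14471, 13856,
    20447, 19540, 14026],
   [7083, 2711, 22693, 14555, 7537, 31723, 15587, 24932, 10964, 15452, 15777, 16933, 14088, 31082,
    1533, 23487, 14023, 18512, 18881, 3372, 11546, 18046, 30166, 19103, 1415, 11853, 17093, 13211,
    11758, 22884, 18089],
   [6888, 20708, 17512, 30855, 1001, 7775, 18491, 1416, 28677, 13427, 28577, 6891, 22275, 8342,
    16911, 5112, 8688, 28744, 4958, 30004, 28148, 27468, 20736, 20485, 18775, 17948, 22684, 15467,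
    20938, 5074, 16328],
   [2703, 25187, 14080, 24976, 27793, 18875, 15605, 11691, 9489, 7476, 5055, 18066, 17026, 6817,
    5811, 21386, 21, 9720, 24779, 9265, 8829, 26078, 9672, 9478, 25001, 28893, 18619, 26921, 14972,
    28762, 28070],
   [21878, 8406, 19930, 18658, 28770, 30658, 28328, 9050, 19671, 30644, 28526, 3923, 17958, 9911,
    23011, 18943, 3060, 8986, 18807, 15344, 18827, 13313, 25292, 11056, 4839, 31671, 12018, 26450,
    29841, 26734, 12491],
   [5375, 1347, 31529, 16145, 9406, 18027, 15279, 19766, 15255, 1830, 27598, 9507, 13759, 31725,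
    16394, 19962, 9424, 16750, 24475, 29418, 28792, 31826, 18961, 15461, 23604, 6396, 31370, 21724,
    11871, 13167, 8486],
   [1917, 13276, 27652, 30380, 13936, 4985, 18188, 8073, 7421, 19105, 28403, 14036, 18900, 29380,
    9484, 1436, 8684, 24605, 25771, 1776, 1093, 10019, 15571, 28504, 31190, 30570, 9134, 31325,
    13073, 13527, 10905],
   [29742, 7009, 24725, 22285, 23521, 18717, 8678, 19443, 2956, 15274, 21652, 15092, 26653, 14338,
    31859, 16416, 21195, 25948, 1516, 8153, 14604, 16346, 16676, 14447, 27096, 24527, 31925, 1188,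
    29527, 21718, 9089],
   [1977, 1718, 4222, 12951, 20928, 25844, 22688, 929, 27686, 29792, 6019, 3275, 4914, 19547,
    31972, 30102, 13450, 8583, 7449, 15901, 30690, 5259, 14258, 30248, 22320, 9847, 29801, 6285,
    2290, 13984, 15025],
   [22519, 16119, 10492, 15495, 25943, 5722, 17808, 15105, 30356, 24915, 8200, 19464, 27489,
    13416, 23855, 2772, 242, 13917, 11294, 10650, 26578, 903, 24964, 12204, 26865, 7475, 7743,
    15789, 23645, 25579, 10298],
   [17097, 11634, 17338, 30025, 924, 24392, 13107, 30750, 14974, 26367, 31764, 20445, 25913,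
    10361, 18506, 4914, 23878, 26042, 25475, 15640, 20677, 19821, 19918, 24844, 21601, 681, 19932,
    20757, 17642, 17716, 879],
   [16832, 14821, 8806, 17080, 5028, 14227, 12763, 6262, 25793, 13006, 10839, 699, 27436, 4632,
    8425, 19372, 9999, 26304, 29343, 4365, 28358, 10899, 9496, 4061, 25750, 22850, 30754, 1773,
    17982, 27659, 3450],
   [19527, 3392, 6150, 13114, 1803, 23770, 26716, 5003, 25676, 17669, 14944, 10328, 7779, 21102,
    13955, 5601, 21567, 20460, 24752, 4860, 8092, 14199, 24703, 16063, 6286, 5200, 18158, 16756,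
    27649, 21369, 17571],
   [17210, 28219, 27873, 18777, 23532, 5954, 2176, 9580, 20883, 2459, 23230, 18358, 2217, 24590,
    15156, 30401, 5675, 28698, 10436, 27764, 6143, 14069, 2425, 24968, 29290, 10786, 28158, 7768,
    6945, 20481, 15093],
   [9001, 5050, 11362, 24113, 28652, 30893, 19411, 27595, 5601, 13436, 27464, 4743, 22979, 7227,
    29462, 1946, 19179, 30226, 137, 29298, 30607, 29798, 14671, 14640, 11430, 18833, 19360, 8427,
    24661, 29427, 15012],
   [30092, 20495, 4676, 3354, 17185, 31727, 3187, 29824, 23648, 10941, 12673, 22510, 3034, 3452,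
    2267, 23644, 2001, 22124, 10898, 5543, 11186, 3537, 13918, 22821, 31035, 12985, 4559, 14534,
    15818, 2772, 4864],
   [7092, 20088, 7252, 15371, 30403, 12891, 14744, 5707, 28317, 7084, 21940, 17346, 1145, 28471,
    17054, 1491, 1536, 3640, 31769, 9763, 19246, 2289, 26949, 15861, 15528, 26483, 25840, 25095,
    22436, 9295, 11894],
   [10995, 3248, 15771, 30539, 29771, 29730, 30838, 5107, 31581, 30334, 22671, 1184, 23059, 22234,
    5943, 14054, 15574, 15092, 21220, 17160, 31917, 31549, 16144, 13833, 12798, 117, 12467, 21492,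
    31582, 11289, 30011],
   [16771, 15168, 17511, 5038, 11467, 23598, 12765, 15068, 448, 8488, 20054, 27660, 20734, 3920,
    23841, 396, 8899, 1922, 25763, 25943, 17372, 8724, 13991, 7539, 17484, 30883, 31168, 776, 1406,
    123, 14031],
   [8527, 3413, 7920, 14829, 26338, 12187, 19399, 16952, 11872, 17041, 7579, 19933, 15821, 25023,
    18333, 17133, 30478, 26301, 22030, 30731, 31281, 15506, 17359, 30155, 31575, 25039, 3337, 7456,
    14550, 5481, 17146],
   [20321, 2208, 18369, 331, 10688, 13240, 11205, 25931, 28007, 22540, 12133, 9327, 12070, 16497,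
    5040, 8930, 2634, 15613, 13167, 539, 15816, 11916, 21511, 15074, 26170, 16448, 22373, 26057,
    26924, 10885, 13110],
   [6168, 8260, 17507, 9874, 14028, 12053, 1579, 7247, 6162, 12095, 26397, 29728, 16361, 23552,
    26150, 8973, 30091, 24711, 6896, 8190, 19428, 9039, 22713, 12141, 11871, 21156, 6890, 8151,
    26572, 23470, 4244],
   [16365, 10642, 14808, 20979, 13580, 22617, 24358, 13688, 29707, 11337, 21762, 28133, 2269,
    14226, 9504, 15545, 23638, 1143, 5226, 7702, 4160, 9582, 4194, 29121, 23990, 25189, 31241,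
    29953, 11674, 21549, 22931]]

def quadIdx : List (Fin 4 × Fin 4) := [(0, 0), (0, 1), (0, 2), (0, 3), (1, 1), (1, 2), (1, 3), (2, 2), (2, 3), (3, 3)]

def cubIdx : List (Fin 5 × Fin 5 × Fin 5) := [(4, 4, 4), (3, 4, 4), (3, 3, 4), (3, 3, 3), (2, 4, 4), (2, 3, 4), (2, 3, 3), (2, 2, 4), (2, 2, 3), (2, 2, 2), (1, 4, 4), (1, 3, 4), (1, 3, 3), (1, 2, 4), (1, 2, 3), (1, 2, 2), (1, 1, 4), (1, 1, 3), (1, 1, 2), (1, 1, 1), (0, 4, 4), (0, 3, 4), (0, 3, 3), (0, 2, 4), (0, 2, 3), (0, 2, 2), (0, 1, 4), (0, 1, 3), (0, 1, 2), (0, 1, 1), (0, 0, 4)]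
section Certificates

open Polynomial in
/-- The polynomial with a given list of coefficients. -/
def tp : List ℕ → F32003[X]
  | [] => 0
  | a :: l => Polynomial.C (a : F32003) + Polynomial.X * tp l

def ladd : List ℕ → List ℕ → List ℕ
  | [], l => l
  | a :: l, [] => a :: l
  | a :: l, b :: m => (a + b) :: ladd l m

def lsmul (c : ℕ) : List ℕ → List ℕ
  | [] => []
  | a :: l => (c * a) :: lsmul c l

def lmul : List ℕ → List ℕ → List ℕ
  | [], _ => []
  | a :: l, m => ladd (lsmul a m) (0 :: lmul l m)

def lzero : List ℕ → Bool
  | [] => true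
  | a :: l => (a % 32003 == 0) && lzero l

def leq : List ℕ → List ℕ → Bool
  | [], m => lzero m
  | a :: l, [] => lzero (a :: l)
  | a :: l, b :: m => (a % 32003 == b % 32003) && leq l m

def lin : List ℕ → List (List ℕ) → List ℕ
  | [], _ => []
  | _ :: _, [] => []
  | c :: cs, r :: rs => ladd (lsmul c r) (lin cs rs)

def unit : ℕ → List ℕ
  | 0 => [1]
  | n + 1 => 0 :: unit n

lemma tp_ladd (l m : List ℕ) : tp (ladd l m) = tp l + tp m := by
  induction l generalizing m with
  | nil => simp [ladd, tp]
  | cons a l ih =>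
    cases m with
    | nil => simp [ladd, tp]
    | cons b m => simp only [ladd, tp, ih, Nat.cast_add, map_add]; ring

lemma tp_lsmul (c : ℕ) (l : List ℕ) : tp (lsmul c l) = (c : F32003) • tp l := by
  induction l with
  | nil => simp [lsmul, tp]
  | cons a l ih =>
    simp only [lsmul, tp, ih, Nat.cast_mul, map_mul, Polynomial.smul_eq_C_mul]; ring

lemma tp_lmul (l m : List ℕ) : tp (lmul l m) = tp l * tp m := by
  induction l with
  | nil => simp [lmul, tp]
  | cons a l ih =>
    simp only [lmul, tp_ladd, tp_lsmul, tp, ih, Polynomial.smul_eq_C_mul, Nat.cast_zero, map_zero]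
    ring

lemma tp_lzero (l : List ℕ) (h : lzero l = true) : tp l = 0 := by
  induction l with
  | nil => simp [tp]
  | cons a l ih =>
    simp only [lzero, Bool.and_eq_true, beq_iff_eq] at h
    have : (a : F32003) = 0 := (ZMod.natCast_eq_zero_iff a 32003).2 (Nat.dvd_of_mod_eq_zero h.1)
    simp [tp, ih h.2, this]

lemma tp_leq (l m : List ℕ) (h : leq l m = true) : tp l = tp m := by
  induction l generalizing m with
  | nil => simp only [leq] at h; rw [tp_lzero m h]; rfl
  | cons a l ih =>
    cases m with
    | nil => simp only [leq] at h; rw [tp_lzero _ h]; rfl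
    | cons b m =>
      simp only [leq, Bool.and_eq_true, beq_iff_eq] at h
      have : (a : F32003) = (b : F32003) := (ZMod.natCast_eq_natCast_iff' a b 32003).2 h.1
      simp [tp, ih m h.2, this]

lemma tp_unit (n : ℕ) : tp (unit n) = Polynomial.X ^ n := by
  induction n with
  | zero => simp [tp, unit]
  | succ n ih => simp [tp, unit, ih, pow_succ']

lemma tp_lin_mem (W : Submodule F32003 (Polynomial F32003)) (cs : List ℕ) (rs : List (List ℕ))
    (h : ∀ r ∈ rs, tp r ∈ W) : tp (lin cs rs) ∈ W := by
  induction cs generalizing rs with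
  | nil => simp [lin, tp]
  | cons c cs ih =>
    cases rs with
    | nil => simp [lin, tp]
    | cons r rs =>
      simp only [lin, tp_ladd, tp_lsmul]
      exact W.add_mem (W.smul_mem _ (h r (by simp))) (ih rs fun r hr => h r (by simp [hr]))

/-- Dehomogenized (`u = 1`) coefficient lists of the five forms. -/
def gl : Fin 5 → List ℕ
  | 0 => [1, 1, 0, 0, 0, 0, 0, 0, 0, 1, 1]
  | 1 => [999, 0, 0, 0, 0, 355, 0, 0, 101, 0, 7]
  | 2 => [83, 0, 67, 99, 0, 0, 0, 0, 0, 0, 29]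
  | 3 => [53, 901, 0, 1, 0, 79, 0, 0, 0, 0, 61]
  | 4 => [9001, 0, 1, 0, 1, 0, 1, 1, 1, 0, 741]

def quadRows : List (List ℕ) :=
  quadIdx.map (fun x => lmul (gl x.1.castSucc) (gl x.2.castSucc)) ++
    (List.range 11).map (fun k => lmul (gl 4) (unit k))

def cubRows : List (List ℕ) :=
  cubIdx.map (fun x => lmul (lmul (gl x.1) (gl x.2.1)) (gl x.2.2))

set_option maxRecDepth 100000 in
lemma bez_check : leq (ladd (lmul bezA (gl 3)) (lmul bezB (gl 4))) [1] = true := by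
  decide +kernel

set_option maxRecDepth 100000 in
lemma quad_check : ∀ i < 10, leq (lin (quadCert.getD i []) quadRows) (unit i) = true := by
  decide +kernel

set_option maxRecDepth 100000 in
lemma cub_check : ∀ i < 31, leq (lin (cubCert.getD i []) cubRows) (unit i) = true := by
  decide +kernel

end Certificates

section Proof

theorem fact_prime_32003 : Fact (Nat.Prime 32003) := ⟨by norm_num⟩

attribute [local instance] fact_prime_32003

/-- The dehomogenized forms. -/
def gp (i : Fin 5) : Polynomial F32003 := tp (gl i)

/-- The dehomogenized parameterization. -/
def psi : MvPolynomial (Fin 5) F32003 →ₐ[F32003] Polynomial F32003 := aeval gp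

lemma tp_cons (a : ℕ) (l : List ℕ) :
    tp (a :: l) = (a : Polynomial F32003) + Polynomial.X * tp l := by
  rw [tp, map_natCast]

lemma tp_nil : tp [] = 0 := rfl

lemma psi_eq (f : MvPolynomial (Fin 5) F32003) :
    aeval ![Polynomial.X, (1 : Polynomial F32003)] (curveMap f) = psi f := by
  have : (aeval ![Polynomial.X, (1 : Polynomial F32003)]).comp curveMap = psi := by
    apply MvPolynomial.algHom_ext
    intro i
    fin_cases i <;> simp [curveMap, psi, gp, gl, tp_cons, tp_nil] <;> ring
  rw [← this]; rfl

lemma curve_hom {f : MvPolynomial (Fin 5) F32003} {n : ℕ} (hf : f.IsHomogeneous n) :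
    (curveMap f).IsHomogeneous (10 * n) := by
  have h0 : ∀ (a k c : ℕ), a + k = 10 →
      ((c : MvPolynomial (Fin 2) F32003) * (X 0 ^ a * X 1 ^ k)).IsHomogeneous 10 := by
    intro a k c h
    have := ((isHomogeneous_X_pow (R := F32003) (0 : Fin 2) a).mul
      (isHomogeneous_X_pow (1 : Fin 2) k)).C_mul (c : F32003)
    rwa [h, map_natCast] at this
  refine hf.aeval _ (fun i => ?_)
  rw [← mem_homogeneousSubmodule]
  fin_cases i <;> dsimp only
  · have := (((h0 10 0 1 rfl).add (h0 9 1 1 rfl)).add (h0 1 9 1 rfl)).add (h0 0 10 1 rfl)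
    rw [← mem_homogeneousSubmodule] at this
    convert this using 1
    simp
  · have := (((h0 10 0 7 rfl).add (h0 8 2 101 rfl)).add (h0 5 5 355 rfl)).add (h0 0 10 999 rfl)
    rw [← mem_homogeneousSubmodule] at this
    convert this using 1
    simp [mul_assoc]
  · have := (((h0 10 0 29 rfl).add (h0 3 7 99 rfl)).add (h0 2 8 67 rfl)).add (h0 0 10 83 rfl)
    rw [← mem_homogeneousSubmodule] at this
    convert this using 1
    simp [mul_assoc]
  · have := ((((h0 10 0 61 rfl).add (h0 5 5 79 rfl)).add (h0 3 7 1 rfl)).add (h0 1 9 901 rfl)).add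
      (h0 0 10 53 rfl)
    rw [← mem_homogeneousSubmodule] at this
    convert this using 1
    simp [mul_assoc]
  · have := ((((((h0 10 0 741 rfl).add (h0 8 2 1 rfl)).add (h0 7 3 1 rfl)).add (h0 6 4 1 rfl)).add
      (h0 4 6 1 rfl)).add (h0 2 8 1 rfl)).add (h0 0 10 9001 rfl)
    rw [← mem_homogeneousSubmodule] at this
    convert this using 1
    simp

lemma curve_eq_zero {f : MvPolynomial (Fin 5) F32003} {n : ℕ} (hf : f.IsHomogeneous n)
    (h : psi f = 0) : curveMap f = 0 := by
  have := Polynomial.homogenize_eq_of_isHomogeneous (curve_hom hf) ((psi_eq f).trans h)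
  simpa using this.symm

lemma psi_natDegree {f : MvPolynomial (Fin 5) F32003} {n : ℕ} (hf : f.IsHomogeneous n) :
    (psi f).natDegree ≤ 10 * n := by
  rw [← psi_eq]
  have h1 := curve_hom hf
  rw [(curveMap f).as_sum, map_sum]
  refine Polynomial.natDegree_sum_le_of_forall_le _ _ fun e he => ?_
  have h2 : e.degree = 10 * n := by
    by_contra h
    exact (mem_support_iff.1 he) (h1.coeff_eq_zero h)
  rw [aeval_monomial]
  simp only [Finsupp.prod_fintype, pow_zero, implies_true, Fin.prod_univ_two]
  have h3 : e 0 ≤ 10 * n := by rw [← h2]; exact Finsupp.le_degree 0 e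
  simp only [Matrix.cons_val_zero, Matrix.cons_val_one, one_pow, mul_one]
  exact (Polynomial.natDegree_C_mul_X_pow_le _ _).trans h3

lemma gp_coprime : IsCoprime (gp 3) (gp 4) := by
  refine ⟨tp bezA, tp bezB, ?_⟩
  have := tp_leq _ _ bez_check
  rw [tp_ladd, tp_lmul, tp_lmul] at this
  simpa [tp, gp] using this

lemma psi_X (i : Fin 5) : psi (X i) = gp i := by simp [psi]

lemma gp4_deg : (gp 4).natDegree = 10 := by
  have h741 : ((741 : ℕ) : F32003) ≠ 0 := by decide
  have : gp 4 = Polynomial.C ((741 : ℕ) : F32003) * Polynomial.X ^ 10 + Polynomial.X ^ 8 + Polynomial.X ^ 7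
      + Polynomial.X ^ 6 + Polynomial.X ^ 4 + Polynomial.X ^ 2 + Polynomial.C ((9001 : ℕ) : F32003) := by
    rw [map_natCast, map_natCast]
    simp [gp, gl, tp_cons, tp_nil]; ring
  rw [this]
  compute_degree!

lemma gp4_ne : gp 4 ≠ 0 := by
  intro h; have := gp4_deg; simp [h] at this

lemma curve_X4_ne : curveMap (X 4) ≠ 0 := by
  intro h; apply gp4_ne; rw [← psi_X, ← psi_eq, h, map_zero]

/-- Cubic forms surject onto polynomials of degree at most 30. -/
lemma cub_surj (p : Polynomial F32003) (hp : p.natDegree ≤ 30) :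
    ∃ h : MvPolynomial (Fin 5) F32003, h.IsHomogeneous 3 ∧ psi h = p := by
  set W := (homogeneousSubmodule (Fin 5) F32003 3).map psi.toLinearMap with hW
  have hrow : ∀ r ∈ cubRows, tp r ∈ W := by
    intro r hr
    obtain ⟨x, -, rfl⟩ := List.mem_map.1 hr
    rw [tp_lmul, tp_lmul]
    refine ⟨X x.1 * X x.2.1 * X x.2.2, ?_, ?_⟩
    · exact ((isHomogeneous_X _ _).mul (isHomogeneous_X _ _)).mul (isHomogeneous_X _ _)
    · simp [psi, gp]
  have hX : ∀ i < 31, (Polynomial.X ^ i : Polynomial F32003) ∈ W := by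
    intro i hi
    rw [← tp_unit, ← tp_leq _ _ (cub_check i hi)]
    exact tp_lin_mem W _ _ hrow
  have : p ∈ W := by
    rw [p.as_sum_range_C_mul_X_pow' (n := 31) (by omega)]
    refine W.sum_mem fun i hi => ?_
    rw [← Polynomial.smul_eq_C_mul]
    exact W.smul_mem _ (hX i (Finset.mem_range.1 hi))
  obtain ⟨h, h1, h2⟩ := this
  exact ⟨h, h1, h2⟩

/-- The ten quadratic monomials in `x₀, …, x₃`. -/
def quadFin : Finset (MvPolynomial (Fin 5) F32003) :=
  open Classical in
  (Finset.univ.filter fun x : Fin 4 × Fin 4 => x.1 ≤ x.2).image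
    fun x => X x.1.castSucc * X x.2.castSucc

/-- The space of quadrics in `x₀, …, x₃`. -/
def quadSpace : Submodule F32003 (MvPolynomial (Fin 5) F32003) :=
  Submodule.span F32003 (quadFin : Set (MvPolynomial (Fin 5) F32003))

lemma XX_mem (i j : Fin 4) :
    (X i.castSucc * X j.castSucc : MvPolynomial (Fin 5) F32003) ∈ quadSpace := by
  classical
  apply Submodule.subset_span
  rcases le_total i j with h | h
  · simp only [quadFin, Finset.coe_image]
    exact ⟨(i, j), by simpa using h, rfl⟩
  · simp only [quadFin, Finset.coe_image]
    exact ⟨(j, i), by simpa using h, mul_comm _ _⟩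

lemma quadFin_card : quadFin.card ≤ 10 := by
  classical
  refine Finset.card_image_le.trans ?_
  decide

instance quadSpace_fin : FiniteDimensional F32003 quadSpace :=
  FiniteDimensional.span_finset F32003 quadFin

lemma quadSpace_finrank : Module.finrank F32003 quadSpace ≤ 10 :=
  (finrank_span_finset_le_card quadFin).trans quadFin_card

lemma quadSpace_hom {q : MvPolynomial (Fin 5) F32003} (hq : q ∈ quadSpace) :
    q.IsHomogeneous 2 := by
  classical
  rw [← mem_homogeneousSubmodule]
  refine (Submodule.span_le.2 ?_ : quadSpace ≤ _) hq
  intro x hx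
  simp only [quadFin, Finset.coe_image] at hx
  obtain ⟨y, -, rfl⟩ := hx
  exact (isHomogeneous_X _ _).mul (isHomogeneous_X _ _)

/-- The quadrics, modulo `g₄`. -/
def quadMap : quadSpace →ₗ[F32003] (Polynomial F32003 ⧸ Ideal.span {gp 4}) :=
  ((Ideal.Quotient.mkₐ F32003 (Ideal.span {gp 4})).comp psi).toLinearMap.comp quadSpace.subtype

lemma quad_surj' (p : Polynomial F32003) : ∃ q ∈ quadSpace, gp 4 ∣ p - psi q := by
  set W := quadSpace.map psi.toLinearMap ⊔ (Ideal.span {gp 4}).restrictScalars F32003 with hW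
  have hrow : ∀ r ∈ quadRows, tp r ∈ W := by
    intro r hr
    rcases List.mem_append.1 hr with hr | hr
    · obtain ⟨x, -, rfl⟩ := List.mem_map.1 hr
      rw [tp_lmul]
      refine Submodule.mem_sup_left ⟨_, XX_mem x.1 x.2, ?_⟩
      simp [psi, gp]
    · obtain ⟨x, -, rfl⟩ := List.mem_map.1 hr
      rw [tp_lmul]
      refine Submodule.mem_sup_right ?_
      rw [Submodule.restrictScalars_mem, Ideal.mem_span_singleton]
      exact Dvd.intro _ rfl
  have hX : ∀ i < 10, (Polynomial.X ^ i : Polynomial F32003) ∈ W := by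
    intro i hi
    rw [← tp_unit, ← tp_leq _ _ (quad_check i hi)]
    exact tp_lin_mem W _ _ hrow
  have : p ∈ W := by
    rw [← EuclideanDomain.div_add_mod p (gp 4)]
    refine W.add_mem (Submodule.mem_sup_right ?_) ?_
    · rw [Submodule.restrictScalars_mem, Ideal.mem_span_singleton]
      exact Dvd.intro _ rfl
    · have hd : (p % gp 4).natDegree < 10 := by
        rw [← gp4_deg]
        exact Polynomial.natDegree_mod_lt _ (by rw [gp4_deg]; norm_num)
      rw [(p % gp 4).as_sum_range_C_mul_X_pow' (n := 10) hd]
      refine W.sum_mem fun i hi => ?_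
      rw [← Polynomial.smul_eq_C_mul]
      exact W.smul_mem _ (hX i (Finset.mem_range.1 hi))
  obtain ⟨a, ⟨q, hq, rfl⟩, b, hb, rfl⟩ := Submodule.mem_sup.1 this
  refine ⟨q, hq, ?_⟩
  rw [Submodule.restrictScalars_mem, Ideal.mem_span_singleton] at hb
  simpa using hb

lemma quadMap_surj : Function.Surjective quadMap := by
  intro y
  obtain ⟨p, rfl⟩ := Ideal.Quotient.mk_surjective y
  obtain ⟨q, hq, h⟩ := quad_surj' p
  refine ⟨⟨q, hq⟩, ?_⟩
  symm
  exact Ideal.Quotient.eq.2 (Ideal.mem_span_singleton.2 h)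

lemma quad_inj {q : MvPolynomial (Fin 5) F32003} (hq : q ∈ quadSpace) (h : gp 4 ∣ psi q) :
    q = 0 := by
  have h10 : Module.finrank F32003 (Polynomial F32003 ⧸ Ideal.span {gp 4}) = 10 := by
    rw [finrank_quotient_span_eq_natDegree, gp4_deg]
  have : FiniteDimensional F32003 (Polynomial F32003 ⧸ Ideal.span {gp 4}) :=
    FiniteDimensional.of_finrank_pos (by rw [h10]; norm_num)
  have h1 := LinearMap.finrank_le_finrank_of_surjective quadMap_surj
  have hinj : Function.Injective quadMap :=
    (LinearMap.injective_iff_surjective_of_finrank_eq_finrank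
      (le_antisymm (by rw [h10]; exact quadSpace_finrank) h1)).2 quadMap_surj
  have h2 : quadMap ⟨q, hq⟩ = 0 :=
    Ideal.Quotient.eq_zero_iff_mem.2 (Ideal.mem_span_singleton.2 h)
  have h3 : (⟨q, hq⟩ : quadSpace) = 0 := hinj (by rw [h2, map_zero])
  exact congrArg Subtype.val h3

end Proof

section Final

attribute [local instance] fact_prime_32003

lemma deg_eq (d : Fin 5 →₀ ℕ) : d.degree = d 0 + d 1 + d 2 + d 3 + d 4 := by
  rw [Finsupp.degree_eq_sum, Fin.sum_univ_five]

lemma expDeg5_eq (d : Fin 5 →₀ ℕ) : expDeg5 d = d.degree := rfl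

lemma hom_deg {f : MvPolynomial (Fin 5) F32003} {n : ℕ} (hf : f.IsHomogeneous n)
    {e : Fin 5 →₀ ℕ} (he : coeff e f ≠ 0) : e.degree = n := by
  by_contra h
  exact he (hf.coeff_eq_zero h)

lemma split_off (e : Fin 5 →₀ ℕ) (h4 : e 4 = 0) (hd : e.degree ≠ 0) :
    ∃ (i : Fin 4) (e' : Fin 5 →₀ ℕ), e = Finsupp.single i.castSucc 1 + e' := by
  have : ∃ i : Fin 4, e i.castSucc ≠ 0 := by
    by_contra! h
    apply hd
    have h0 := h 0
    have h1 := h 1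
    have h2 := h 2
    have h3 := h 3
    simp only [Fin.castSucc_zero, Fin.castSucc_one] at h0 h1
    change e 2 = 0 at h2
    change e 3 = 0 at h3
    rw [deg_eq]; omega
  obtain ⟨i, hi⟩ := this
  refine ⟨i, e - Finsupp.single i.castSucc 1, ?_⟩
  rw [add_tsub_cancel_of_le]
  rw [Finsupp.single_le_iff]
  omega

lemma mem_quadSpace {q : MvPolynomial (Fin 5) F32003} (hq : q.IsHomogeneous 2)
    (h4 : ∀ e, coeff e q ≠ 0 → e 4 = 0) : q ∈ quadSpace := by
  rw [q.as_sum]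
  refine quadSpace.sum_mem fun e he => ?_
  rw [mem_support_iff] at he
  have hd := hom_deg hq he
  have he4 := h4 e he
  obtain ⟨i, e', rfl⟩ := split_off e he4 (by omega)
  have he4' : e' 4 = 0 := by
    rw [Finsupp.add_apply] at he4; omega
  rw [map_add, Finsupp.degree_single] at hd
  obtain ⟨j, e'', rfl⟩ := split_off e' he4' (by omega)
  rw [map_add, Finsupp.degree_single] at hd
  have h0 : e'' = 0 := by
    rw [← Finsupp.degree_eq_zero_iff]; omega
  subst h0
  have : monomial (Finsupp.single i.castSucc 1 + (Finsupp.single j.castSucc 1 + 0))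
      (coeff (Finsupp.single i.castSucc 1 + (Finsupp.single j.castSucc 1 + 0)) q) =
      (coeff (Finsupp.single i.castSucc 1 + (Finsupp.single j.castSucc 1 + 0)) q) •
        (X i.castSucc * X j.castSucc : MvPolynomial (Fin 5) F32003) := by
    rw [X, X, monomial_mul, smul_monomial, add_zero]
    simp
  rw [this]
  exact quadSpace.smul_mem _ (XX_mem i j)

/-- Every quartic monomial without `x₄` and with `x₃`-exponent at most one is a leading
monomial. -/
lemma lead_quartic (e : Fin 5 →₀ ℕ) (h4 : e 4 = 0) (hd : e.degree = 4) (h3 : e 3 ≤ 1) :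
    ∃ f ∈ RingHom.ker curveMap.toRingHom, f ≠ 0 ∧ f.totalDegree ≤ 4 ∧ IsLeadExponent f e := by
  have hm : (monomial e (1 : F32003)).IsHomogeneous 4 := isHomogeneous_monomial _ hd
  obtain ⟨a, b, hab⟩ := (gp_coprime.pow_left (m := 2))
  obtain ⟨q, hq, hdvd⟩ := quad_surj' (a * psi (monomial e 1))
  have hdvd2 : gp 4 ∣ psi (monomial e 1 - X 3 ^ 2 * q) := by
    have : psi (monomial e 1 - X 3 ^ 2 * q) = gp 3 ^ 2 * (a * psi (monomial e 1) - psi q)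
        + gp 4 * (b * psi (monomial e 1)) := by
      rw [map_sub, map_mul, map_pow, psi_X]
      linear_combination (-psi (monomial e 1)) * hab
    rw [this]
    exact dvd_add (hdvd.mul_left _) (Dvd.intro _ rfl)
  have hhom : (monomial e 1 - X 3 ^ 2 * q : MvPolynomial (Fin 5) F32003).IsHomogeneous 4 :=
    hm.sub ((isHomogeneous_X_pow _ 2).mul (quadSpace_hom hq))
  obtain ⟨H, hH⟩ := hdvd2
  have hHdeg : H.natDegree ≤ 30 := by
    by_cases h0 : H = 0
    · simp [h0]
    have h1 := psi_natDegree hhom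
    rw [hH, Polynomial.natDegree_mul gp4_ne h0, gp4_deg] at h1
    omega
  obtain ⟨h, hh, hpsi⟩ := cub_surj H hHdeg
  set f : MvPolynomial (Fin 5) F32003 := monomial e 1 - X 3 ^ 2 * q - X 4 * h with hf
  have hfhom : f.IsHomogeneous 4 := hhom.sub ((isHomogeneous_X _ _).mul hh)
  have hf0 : curveMap f = 0 := by
    apply curve_eq_zero hfhom
    rw [hf, map_sub, hH, map_mul, psi_X, hpsi, sub_self]
  have hX3 : (X 3 ^ 2 : MvPolynomial (Fin 5) F32003) = monomial (Finsupp.single 3 2) 1 :=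
    X_pow_eq_monomial
  have hX4 : (X 4 : MvPolynomial (Fin 5) F32003) = monomial (Finsupp.single 4 1) 1 := rfl
  have hco : ∀ e' : Fin 5 →₀ ℕ, e' 4 = 0 → e' 3 ≤ 1 →
      coeff e' f = coeff e' (monomial e (1 : F32003)) := by
    intro e' h4' h3'
    rw [hf, coeff_sub, coeff_sub, hX3, hX4, coeff_monomial_mul', coeff_monomial_mul', if_neg,
      if_neg]
    · simp
    · rw [Finsupp.single_le_iff]; omega
    · rw [Finsupp.single_le_iff]; omega
  have hce : coeff e f = 1 := by rw [hco e h4 h3]; simp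
  refine ⟨f, hf0, ?_, hfhom.totalDegree_le, ?_, ?_⟩
  · intro h0; simp [h0] at hce
  · rw [mem_support_iff, hce]; exact one_ne_zero
  · intro e' he' hne
    rw [mem_support_iff] at he'
    right
    rw [expDeg5_eq, expDeg5_eq]
    refine ⟨(hom_deg hfhom he').trans hd.symm, ?_⟩
    by_cases h4' : e' 4 = 0
    · refine ⟨3, ?_, ?_⟩
      · by_contra h3'
        apply he'
        rw [hco e' h4' (by omega), coeff_monomial, if_neg (Ne.symm hne)]
      · intro j hj
        have : j = 4 := by revert hj; revert j; decide
        rw [this, h4, h4']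
    · exact ⟨4, by omega, fun j hj => absurd hj (by revert j; decide)⟩

/-- In high degree, a leading monomial without `x₄` is not of the form `x₃ⁿ⁻² q`. -/
lemma lead_not_std {f : MvPolynomial (Fin 5) F32003} {n : ℕ} (hf : f.IsHomogeneous n)
    (h0 : curveMap f = 0) (hn : 2 ≤ n) {d : Fin 5 →₀ ℕ} (hd : IsLeadExponent f d)
    (h4 : d 4 = 0) (h3 : n ≤ d 3 + 2) : False := by
  have hlow : ∀ e, coeff e f ≠ 0 → e 4 = 0 → n - 2 ≤ e 3 := by
    intro e he he4
    by_cases hed : e = d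
    · rw [hed]; omega
    have h1 := hom_deg hf he
    have h2 := hom_deg hf (mem_support_iff.1 hd.1)
    rcases hd.2 e (mem_support_iff.2 he) hed with h | ⟨-, i, hi, hj⟩
    · rw [expDeg5_eq, expDeg5_eq] at h; omega
    · by_cases hi3 : i = 3
      · subst hi3; omega
      by_cases hi4 : i = 4
      · subst hi4; omega
      have : i < 3 := by clear hi hj; revert hi3 hi4; revert i; decide
      have := hj 3 this
      omega
  set r := f.modMonomial (Finsupp.single 4 1) with hr
  have hfr := divMonomial_add_modMonomial_single f 4
  rw [← hr] at hfr
  have hrc : ∀ e, coeff e r ≠ 0 → coeff e f ≠ 0 ∧ e 4 = 0 := by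
    intro e he
    by_cases hle : Finsupp.single 4 1 ≤ e
    · rw [hr, coeff_modMonomial_of_le _ hle] at he; exact absurd rfl he
    · rw [hr, coeff_modMonomial_of_not_le _ hle] at he
      rw [Finsupp.single_le_iff] at hle
      exact ⟨he, by omega⟩
  set q := r.divMonomial (Finsupp.single 3 (n - 2)) with hq
  have hrq := divMonomial_add_modMonomial r (Finsupp.single 3 (n - 2))
  rw [← hq] at hrq
  have hmod : r.modMonomial (Finsupp.single 3 (n - 2)) = 0 := by
    ext e
    by_cases hle : Finsupp.single 3 (n - 2) ≤ e
    · rw [coeff_modMonomial_of_le _ hle]; simp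
    · rw [coeff_modMonomial_of_not_le _ hle, coeff_zero]
      by_contra he
      obtain ⟨h1, h2⟩ := hrc e he
      exact hle (Finsupp.single_le_iff.2 (hlow e h1 h2))
  rw [hmod, add_zero] at hrq
  have hqc : ∀ e, coeff e q ≠ 0 → e.degree = 2 ∧ e 4 = 0 := by
    intro e he
    rw [hq, coeff_divMonomial] at he
    obtain ⟨h1, h2⟩ := hrc _ he
    have h5 := hom_deg hf h1
    rw [map_add, Finsupp.degree_single] at h5
    rw [Finsupp.add_apply] at h2
    omega
  have hqhom : q.IsHomogeneous 2 := by
    intro e he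
    have := (hqc e he).1
    rw [← this, Finsupp.degree_eq_weight_one]; rfl
  have hqs : q ∈ quadSpace := mem_quadSpace hqhom fun e he => (hqc e he).2
  have hpsi0 : psi f = 0 := by rw [← psi_eq, h0, map_zero]
  have hdvd : gp 4 ∣ gp 3 ^ (n - 2) * psi q := by
    rw [← hfr, ← hrq, ← X_pow_eq_monomial, map_add, map_mul, map_mul, map_pow, psi_X, psi_X]
      at hpsi0
    rw [eq_neg_of_add_eq_zero_right hpsi0]
    exact (Dvd.intro _ rfl : gp 4 ∣ _).neg_right
  have hq0 : q = 0 := quad_inj hqs ((gp_coprime.symm.pow_right).dvd_of_dvd_mul_left hdvd)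
  rw [hq0, mul_zero] at hrq
  have hdr : coeff d r = coeff d f := by
    rw [hr, coeff_modMonomial_of_not_le]
    rw [Finsupp.single_le_iff]; omega
  rw [← hrq, coeff_zero] at hdr
  exact (mem_support_iff.1 hd.1) hdr.symm

/-- The kernel is homogeneous. -/
lemma ker_component {f : MvPolynomial (Fin 5) F32003} (hf : curveMap f = 0) (n : ℕ) :
    curveMap (homogeneousComponent n f) = 0 := by
  have h1 : curveMap f = ∑ i ∈ Finset.range (f.totalDegree + 1),
      curveMap (homogeneousComponent i f) := by
    rw [← map_sum, sum_homogeneousComponent]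
  by_cases hn : f.totalDegree < n
  · rw [homogeneousComponent_eq_zero _ _ hn, map_zero]
  have h2 := congrArg (homogeneousComponent (10 * n)) h1
  rw [hf, map_zero, map_sum, Finset.sum_eq_single n] at h2
  · rw [homogeneousComponent_of_mem (curve_hom (homogeneousComponent_isHomogeneous n f)),
      if_pos rfl] at h2
    exact h2.symm
  · intro b _ hb
    rw [homogeneousComponent_of_mem (curve_hom (homogeneousComponent_isHomogeneous b f)), if_neg]
    omega
  · intro h
    exact absurd (Finset.mem_range.2 (by omega)) h

lemma lead_component {f : MvPolynomial (Fin 5) F32003} {d : Fin 5 →₀ ℕ}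
    (hd : IsLeadExponent f d) : IsLeadExponent (homogeneousComponent d.degree f) d := by
  refine ⟨?_, ?_⟩
  · rw [mem_support_iff, coeff_homogeneousComponent, if_pos rfl]
    exact mem_support_iff.1 hd.1
  · intro e he hne
    rw [mem_support_iff, coeff_homogeneousComponent] at he
    refine hd.2 e (mem_support_iff.2 fun h => he ?_) hne
    simp [h]

/-- Divide out a power of `x₄`. -/
lemma lead_div {f : MvPolynomial (Fin 5) F32003} {n : ℕ} (hf : f.IsHomogeneous n)
    (h0 : curveMap f = 0) {d : Fin 5 →₀ ℕ} (hd : IsLeadExponent f d) :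
    ∃ (f' : MvPolynomial (Fin 5) F32003) (d' : Fin 5 →₀ ℕ), f'.IsHomogeneous d'.degree ∧
      curveMap f' = 0 ∧ IsLeadExponent f' d' ∧ d' 4 = 0 ∧ d' ≤ d := by
  set s : Fin 5 →₀ ℕ := Finsupp.single 4 (d 4) with hs
  have hlow : ∀ e, coeff e f ≠ 0 → s ≤ e := by
    intro e he
    rw [hs, Finsupp.single_le_iff]
    by_cases hed : e = d
    · rw [hed]
    have h1 := hom_deg hf he
    have h2 := hom_deg hf (mem_support_iff.1 hd.1)
    rcases hd.2 e (mem_support_iff.2 he) hed with h | ⟨-, i, hi, hj⟩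
    · rw [expDeg5_eq, expDeg5_eq] at h; omega
    · by_cases hi4 : i = 4
      · subst hi4; omega
      have : i < 4 := by clear hi hj; revert hi4; revert i; decide
      exact (hj 4 this).ge
  have hfm := divMonomial_add_modMonomial f s
  have hmod : f.modMonomial s = 0 := by
    ext e
    by_cases hle : s ≤ e
    · rw [coeff_modMonomial_of_le _ hle]; simp
    · rw [coeff_modMonomial_of_not_le _ hle, coeff_zero]
      by_contra he
      exact hle (hlow e he)
  rw [hmod, add_zero] at hfm
  have hsd : s ≤ d := hlow d (mem_support_iff.1 hd.1)
  have hdd : s + (d - s) = d := add_tsub_cancel_of_le hsd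
  have hdn := hom_deg hf (mem_support_iff.1 hd.1)
  have hdeg : s.degree + (d - s).degree = n := by rw [← map_add, hdd, hdn]
  refine ⟨f.divMonomial s, d - s, ?_, ?_, ⟨?_, ?_⟩, ?_, tsub_le_self⟩
  · intro e he
    rw [coeff_divMonomial] at he
    have h1 := hom_deg hf he
    rw [map_add] at h1
    have : e.degree = (d - s).degree := by omega
    rw [← this, Finsupp.degree_eq_weight_one]; rfl
  · rw [← hfm, hs, ← X_pow_eq_monomial, map_mul, map_pow] at h0
    exact (mul_eq_zero.1 h0).resolve_left (pow_ne_zero _ curve_X4_ne)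
  · rw [mem_support_iff, coeff_divMonomial, hdd]
    exact mem_support_iff.1 hd.1
  · intro e he hne
    rw [mem_support_iff, coeff_divMonomial] at he
    have h1 := hom_deg hf he
    rw [map_add] at h1
    have hne' : s + e ≠ d := by
      intro h; apply hne; rw [← h, add_tsub_cancel_left]
    rcases hd.2 _ (mem_support_iff.2 he) hne' with h | ⟨-, i, hi, hj⟩
    · rw [expDeg5_eq, expDeg5_eq, map_add] at h; omega
    · right
      rw [expDeg5_eq, expDeg5_eq]
      refine ⟨by omega, i, ?_, ?_⟩
      · rw [← hdd] at hi
        simp only [Finsupp.add_apply] at hi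
        omega
      · intro j hij
        have := hj j hij
        rw [← hdd] at this
        simp only [Finsupp.add_apply] at this
        omega
  · simp [hs]

lemma exists_quartic (d : Fin 5 →₀ ℕ) (h5 : 5 ≤ d.degree) (h4 : d 4 = 0)
    (h3 : d 3 + 3 ≤ d.degree) :
    ∃ e : Fin 5 →₀ ℕ, e ≤ d ∧ e 4 = 0 ∧ e.degree = 4 ∧ e 3 ≤ 1 := by
  rw [deg_eq] at h5 h3
  have : ∃ a b c k : ℕ, a ≤ d 0 ∧ b ≤ d 1 ∧ c ≤ d 2 ∧ k ≤ d 3 ∧ k ≤ 1 ∧ a + b + c + k = 4 := by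
    by_cases hk : d 3 = 0
    · refine ⟨min (d 0) 4, min (d 1) (4 - min (d 0) 4),
        4 - min (d 0) 4 - min (d 1) (4 - min (d 0) 4), 0, ?_, ?_, ?_, ?_, ?_, ?_⟩ <;> omega
    · refine ⟨min (d 0) 3, min (d 1) (3 - min (d 0) 3),
        3 - min (d 0) 3 - min (d 1) (3 - min (d 0) 3), 1, ?_, ?_, ?_, ?_, ?_, ?_⟩ <;> omega
  obtain ⟨a, b, c, k, ha, hb, hc, hk, hk1, hsum⟩ := this
  refine ⟨Finsupp.equivFunOnFinite.symm ![a, b, c, k, 0], ?_, ?_, ?_, ?_⟩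
  · intro i
    fin_cases i
    · exact ha
    · exact hb
    · exact hc
    · exact hk
    · exact Nat.zero_le _
  · rfl
  · rw [deg_eq]
    exact hsum
  · exact hk1

end Final

/-- The degrevlex initial ideal of the homogeneous ideal of the generic degree-10 rational
curve `(g₀ : g₁ : g₂ : g₃ : g₄) : ℙ¹ → ℙ⁴` over `𝔽₃₂₀₀₃` is generated by its monomials of
total degree at most 4, i.e. by the leading monomials of the nonzero elements of the
kernel of total degree at most 4.  (This witnesses that a generic rational curve of
degree 10 in `ℙ⁴` is 4-regular.) -/
theorem initial_ideal_of_generic_degree_ten_curve_generated_in_degree_four :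
    initialIdeal (RingHom.ker curveMap.toRingHom) =
      Ideal.span {m | ∃ f ∈ RingHom.ker curveMap.toRingHom, f ≠ 0 ∧ f.totalDegree ≤ 4 ∧
        ∃ d : Fin 5 →₀ ℕ, IsLeadExponent f d ∧ m = monomial d (1 : F32003)} := by
  apply le_antisymm
  · refine Ideal.span_le.2 ?_
    rintro m ⟨f, hf, -, d, hd, rfl⟩
    have hf0 : curveMap f = 0 := hf
    obtain ⟨f', d', hhom, hf'0, hd', hd4, hle⟩ :=
      lead_div (homogeneousComponent_isHomogeneous d.degree f) (ker_component hf0 _)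
        (lead_component hd)
    have key : ∃ e ≤ d, ∃ g ∈ RingHom.ker curveMap.toRingHom, g ≠ 0 ∧ g.totalDegree ≤ 4 ∧
        IsLeadExponent g e := by
      by_cases h5 : 5 ≤ d'.degree
      · have h3 : d' 3 + 3 ≤ d'.degree := by
          by_contra h
          exact lead_not_std hhom hf'0 (by omega) hd' hd4 (by omega)
        obtain ⟨e, hed, he4, hedeg, he3⟩ := exists_quartic d' h5 hd4 h3
        exact ⟨e, hed.trans hle, lead_quartic e he4 hedeg he3⟩
      · refine ⟨d', hle, f', hf'0, ?_, ?_, hd'⟩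
        · intro h
          have := mem_support_iff.1 hd'.1
          simp [h] at this
        · exact hhom.totalDegree_le.trans (by omega)
    obtain ⟨e, hed, g, hg, hg0, hg4, hge⟩ := key
    have hmul : monomial d (1 : F32003) = monomial (d - e) 1 * monomial e 1 := by
      rw [monomial_mul, tsub_add_cancel_of_le hed, one_mul]
    rw [hmul]
    exact Ideal.mul_mem_left _ _ (Ideal.subset_span ⟨g, hg, hg0, hg4, e, hge, rfl⟩)
  · refine Ideal.span_mono ?_
    rintro m ⟨f, hf, hf0, -, d, hd, rfl⟩
    exact ⟨f, hf, hf0, d, hd, rfl⟩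

end
end
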